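/- For every word ω over {1,2,3} of length k ≥ 1 and every point (a,b) ∈ ℝ², one has ∫_{Δ_ω} ‖x − (a,b)‖² dP(x) = p_ω · ( s_ω² · (27/176) + ‖S_ω(1/2, √3/4) − (a,b)‖² ), where ‖·‖ is the Euclidean norm on ℝ². -/

import Mathlib

open MeasureTheory Real Set
open scoped ENNReal NNReal

/-- The three contractive similarities generating the nonhomogeneous R-triangle.
Letters 1,2,3 of the paper correspond to `0,1,2 : Fin 3`. -/
noncomputable def Smap : Fin 3 → ℝ × ℝ → ℝ × ℝ :=
  ![fun x => (x.1 / 4, x.2 / 4),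
    fun x => (x.1 / 4 + 3 / 4, x.2 / 4),
    fun x => (x.1 / 2 + 1 / 4, x.2 / 2 + Real.sqrt 3 / 4)]

/-- `Sw ω = S_{ω₁} ∘ ⋯ ∘ S_{ω_k}` for a word `ω = ω₁⋯ω_k`. -/
noncomputable def Sw (ω : List (Fin 3)) : ℝ × ℝ → ℝ × ℝ :=
  (ω.map Smap).foldr (· ∘ ·) id

/-- The probability weights `p₁ = p₂ = 1/5`, `p₃ = 3/5`. -/
noncomputable def pr : Fin 3 → ℝ := ![1/5, 1/5, 3/5]

/-- The similarity ratios `s₁ = s₂ = 1/4`, `s₃ = 1/2`. -/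
noncomputable def sr : Fin 3 → ℝ := ![1/4, 1/4, 1/2]

/-- `p_ω = p_{ω₁}⋯p_{ω_k}`. -/
noncomputable def pw (ω : List (Fin 3)) : ℝ := (ω.map pr).prod

/-- `s_ω = s_{ω₁}⋯s_{ω_k}`. -/
noncomputable def sw (ω : List (Fin 3)) : ℝ := (ω.map sr).prod

/-- `P` is the nonhomogeneous R-measure:
`P = (1/5)·P∘S₁⁻¹ + (1/5)·P∘S₂⁻¹ + (3/5)·P∘S₃⁻¹`. -/
def IsRMeasure (P : Measure (ℝ × ℝ)) : Prop :=
  P = (1/5 : ℝ≥0∞) • P.map (Smap 0) + (1/5 : ℝ≥0∞) • P.map (Smap 1)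
        + (3/5 : ℝ≥0∞) • P.map (Smap 2)

/-- The closed equilateral triangle with vertices (0,0), (1,0), (1/2, √3/2). -/
noncomputable def Δtri : Set (ℝ × ℝ) :=
  convexHull ℝ ({(0, 0), (1, 0), (1/2, Real.sqrt 3 / 2)} : Set (ℝ × ℝ))

/-- Squared Euclidean distance on ℝ². -/
def sqDist (x a : ℝ × ℝ) : ℝ := (x.1 - a.1) ^ 2 + (x.2 - a.2) ^ 2

/-- The three affine functionals whose non-negativity cuts out the triangle `Δtri`. -/
noncomputable def side : Fin 3 → ℝ × ℝ → ℝ :=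
  ![fun x => x.2, fun x => √3 * x.1 - x.2, fun x => √3 * (1 - x.1) - x.2]

lemma continuous_side (j : Fin 3) : Continuous (side j) := by
  fin_cases j <;> simp only [side] <;> dsimp <;> fun_prop

lemma mem_Δtri_iff (x : ℝ × ℝ) : x ∈ Δtri ↔ ∀ j, 0 ≤ side j x := by
  have h3 : 0 < √3 := by positivity
  constructor
  · intro hx j
    have hconv : Convex ℝ {y : ℝ × ℝ | 0 ≤ side j y} := by
      intro y hy z hz s t hs ht hst
      have ht' : t = 1 - s := by linarith
      have hcomb : side j (s • y + t • z) = s * side j y + t * side j z := by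
        subst ht'
        fin_cases j <;> simp [side] <;> ring
      have h1 := mul_nonneg hs hy
      have h2 := mul_nonneg ht hz
      simp only [mem_ofPred_eq, hcomb]
      linarith
    refine convexHull_min ?_ hconv hx
    rintro y (rfl | rfl | rfl) <;> fin_cases j <;> simp [side] <;> linarith
  · intro h
    have h0 : 0 ≤ x.2 := h 0
    have h1 : 0 ≤ √3 * x.1 - x.2 := h 1
    have h2 : 0 ≤ √3 * (1 - x.1) - x.2 := h 2
    have hconv := (convex_convexHull ℝ
      ({(0, 0), (1, 0), (1/2, √3 / 2)} : Set (ℝ × ℝ))).sum_mem (t := Finset.univ)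
      (w := ![1 - x.1 - x.2 / √3, x.1 - x.2 / √3, 2 * x.2 / √3])
      (z := ![(0, 0), (1, 0), (1/2, √3 / 2)])
    have h1' : x.2 / √3 ≤ x.1 := by rw [div_le_iff₀ h3]; linarith
    have h2' : x.2 / √3 ≤ 1 - x.1 := by rw [div_le_iff₀ h3]; linarith
    have hx : x = ∑ i, (![1 - x.1 - x.2 / √3, x.1 - x.2 / √3, 2 * x.2 / √3] : Fin 3 → ℝ) i •
        (![(0, 0), (1, 0), (1/2, √3 / 2)] : Fin 3 → ℝ × ℝ) i := by
      ext
      · simp [Fin.sum_univ_three]; ring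
      · simp [Fin.sum_univ_three]; field_simp
    rw [hx]
    refine hconv ?_ ?_ ?_
    · intro i _
      fin_cases i
      · simp; linarith
      · simp; linarith
      · simp; positivity
    · simp [Fin.sum_univ_three]; ring
    · intro i _
      fin_cases i <;> exact subset_convexHull ℝ _ (by simp)

lemma isCompact_Δtri : IsCompact Δtri :=
  Set.Finite.isCompact_convexHull (𝕜 := ℝ) (by simp)

lemma sr_pos (i : Fin 3) : 0 < sr i := by fin_cases i <;> simp [sr]

lemma sr_le (i : Fin 3) : sr i ≤ 1 / 2 := by fin_cases i <;> norm_num [sr]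

lemma pr_nonneg (i : Fin 3) : 0 ≤ pr i := by fin_cases i <;> norm_num [pr]

lemma sum_pr : ∑ i, pr i = 1 := by simp [Fin.sum_univ_three, pr]; norm_num

lemma continuous_Smap (i : Fin 3) : Continuous (Smap i) := by
  fin_cases i <;> simp only [Smap] <;> dsimp <;> fun_prop

lemma injective_Smap (i : Fin 3) : Function.Injective (Smap i) := by
  rintro ⟨a, b⟩ ⟨c, d⟩ h
  fin_cases i <;> simpa [Smap] using h

lemma sr_mul_side_le (i j : Fin 3) (x : ℝ × ℝ) : sr i * side j x ≤ side j (Smap i x) := by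
  have h3 : 0 < √3 := by positivity
  fin_cases i <;> fin_cases j <;> simp [sr, side, Smap] <;> linarith

lemma mapsTo_Smap (i : Fin 3) : MapsTo (Smap i) Δtri Δtri := fun x hx =>
  (mem_Δtri_iff _).2 fun j =>
    (mul_nonneg (sr_pos i).le ((mem_Δtri_iff x).1 hx j)).trans (sr_mul_side_le i j x)

lemma eq_of_Smap_eq {i j : Fin 3} {x y : ℝ × ℝ} (hx : x ∈ Δtri) (hy : y ∈ Δtri)
    (h : Smap i x = Smap j y) : i = j := by
  have h3 : 0 < √3 := by positivity
  rw [mem_Δtri_iff] at hx hy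
  have hx0 : 0 ≤ x.2 := hx 0
  have hx1 : 0 ≤ √3 * x.1 - x.2 := hx 1
  have hx2 : 0 ≤ √3 * (1 - x.1) - x.2 := hx 2
  have hy0 : 0 ≤ y.2 := hy 0
  have hy1 : 0 ≤ √3 * y.1 - y.2 := hy 1
  have hy2 : 0 ≤ √3 * (1 - y.1) - y.2 := hy 2
  have hfst := congrArg Prod.fst h
  have hsnd := congrArg Prod.snd h
  have hx3 : 0 ≤ x.1 := nonneg_of_mul_nonneg_right (by linarith) h3
  have hx4 : 0 ≤ 1 - x.1 := nonneg_of_mul_nonneg_right (by linarith) h3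
  have hy3 : 0 ≤ y.1 := nonneg_of_mul_nonneg_right (by linarith) h3
  have hy4 : 0 ≤ 1 - y.1 := nonneg_of_mul_nonneg_right (by linarith) h3
  fin_cases i <;> fin_cases j <;> simp [Smap] at hfst hsnd ⊢ <;> linarith

lemma IsRMeasure.eq_sum {P : Measure (ℝ × ℝ)} (hP : IsRMeasure P) :
    P = ∑ i, ENNReal.ofReal (pr i) • P.map (Smap i) := by
  have h1 : ENNReal.ofReal (1 / 5) = 1 / 5 := by
    rw [ENNReal.ofReal_div_of_pos (by norm_num)]; simp
  have h3 : ENNReal.ofReal (3 / 5) = 3 / 5 := by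
    rw [ENNReal.ofReal_div_of_pos (by norm_num)]; simp
  conv_lhs => rw [hP]
  simp only [Fin.sum_univ_three, pr, Matrix.cons_val_zero, Matrix.cons_val_one, Matrix.cons_val,
    h1, h3]

lemma IsRMeasure.apply {P : Measure (ℝ × ℝ)} (hP : IsRMeasure P) {A : Set (ℝ × ℝ)}
    (hA : MeasurableSet A) : P A = ∑ i, ENNReal.ofReal (pr i) * P (Smap i ⁻¹' A) := by
  conv_lhs => rw [hP.eq_sum]
  simp [Measure.map_apply (continuous_Smap _).measurable hA]

lemma IsRMeasure.measure_side_lt {P : Measure (ℝ × ℝ)} (hP : IsRMeasure P) (j : Fin 3)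
    {t : ℝ} (ht : 0 < t) : P {x | side j x < -t} ≤ P {x | side j x < -(2 * t)} := by
  rw [hP.apply (measurableSet_lt (continuous_side j).measurable measurable_const)]
  calc ∑ i, ENNReal.ofReal (pr i) * P (Smap i ⁻¹' {x | side j x < -t})
      ≤ ∑ i, ENNReal.ofReal (pr i) * P {x | side j x < -(2 * t)} := by
        gcongr with i
        intro x hx
        have h1 := sr_mul_side_le i j x
        have h2 := sr_le i
        have h3 := sr_pos i
        simp only [mem_preimage, mem_ofPred_eq] at hx ⊢
        by_contra! hc
        nlinarith
    _ = P {x | side j x < -(2 * t)} := by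
        rw [← Finset.sum_mul, ← ENNReal.ofReal_sum_of_nonneg fun i _ => pr_nonneg i, sum_pr]
        simp

lemma IsRMeasure.ae_side_nonneg {P : Measure (ℝ × ℝ)} [IsFiniteMeasure P] (hP : IsRMeasure P)
    (j : Fin 3) : ∀ᵐ x ∂P, 0 ≤ side j x := by
  have hzero (t : ℝ) (ht : 0 < t) : P {x | side j x < -t} = 0 := by
    have hle (n : ℕ) : P {x | side j x < -t} ≤ P {x | side j x < -(2 ^ n * t)} := by
      induction n with
      | zero => simp
      | succ n ih =>
        refine ih.trans ((hP.measure_side_lt j (by positivity)).trans_eq ?_)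
        rw [pow_succ', mul_assoc]
    have hpow : Filter.Tendsto (fun n : ℕ => (2 : ℝ) ^ n * t) Filter.atTop Filter.atTop :=
      (tendsto_pow_atTop_atTop_of_one_lt one_lt_two).atTop_mul_const ht
    have hlim : Filter.Tendsto (fun n : ℕ => P {x | side j x < -(2 ^ n * t)}) Filter.atTop
        (nhds (P (⋂ n : ℕ, {x | side j x < -(2 ^ n * t)}))) := by
      refine tendsto_measure_iInter_atTop (fun n => (measurableSet_lt
        (continuous_side j).measurable measurable_const).nullMeasurableSet) ?_
        ⟨0, measure_ne_top _ _⟩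
      intro m n hmn x hx
      simp only [mem_ofPred_eq] at hx ⊢
      refine lt_of_lt_of_le hx (neg_le_neg ?_)
      gcongr
      exact one_le_two
    have hempty : ⋂ n : ℕ, {x | side j x < -(2 ^ n * t)} = ∅ := by
      refine eq_empty_of_forall_notMem fun x hx => ?_
      obtain ⟨n, hn⟩ := (hpow.eventually_ge_atTop (-side j x)).exists
      have := mem_iInter.1 hx n
      simp only [mem_ofPred_eq] at this
      linarith
    rw [hempty, measure_empty] at hlim
    exact le_antisymm (ge_of_tendsto' hlim hle) zero_le
  have hae : ∀ᵐ x ∂P, ∀ n : ℕ, -(1 / ((n : ℝ) + 1)) ≤ side j x := by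
    refine ae_all_iff.2 fun n => ?_
    rw [ae_iff]
    simpa only [not_le] using hzero (1 / ((n : ℝ) + 1)) (by positivity)
  filter_upwards [hae] with x hx
  by_contra! hc
  obtain ⟨n, hn⟩ := exists_nat_one_div_lt (neg_pos.2 hc)
  linarith [hx n]

lemma IsRMeasure.ae_mem_Δtri {P : Measure (ℝ × ℝ)} [IsFiniteMeasure P] (hP : IsRMeasure P) :
    ∀ᵐ x ∂P, x ∈ Δtri := by
  simp only [mem_Δtri_iff]
  exact ae_all_iff.2 hP.ae_side_nonneg

lemma IsRMeasure.restrict_image_Smap {P : Measure (ℝ × ℝ)} [IsFiniteMeasure P]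
    (hP : IsRMeasure P) (i : Fin 3) {A : Set (ℝ × ℝ)} (hA : IsCompact A) (hAΔ : A ⊆ Δtri) :
    P.restrict (Smap i '' A) = ENNReal.ofReal (pr i) • (P.restrict A).map (Smap i) := by
  ext B hB
  have hmeas : Measurable (Smap i) := (continuous_Smap i).measurable
  have himage : MeasurableSet (Smap i '' A) := (hA.image (continuous_Smap i)).measurableSet
  rw [Measure.restrict_apply hB, hP.apply (hB.inter himage), Finset.sum_eq_single i]
  · rw [Measure.smul_apply, Measure.map_apply hmeas hB, Measure.restrict_apply (hmeas hB),
      preimage_inter, (injective_Smap i).preimage_image, smul_eq_mul]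
  · intro j _ hji
    refine mul_eq_zero_of_right _ (measure_mono_null ?_ (ae_iff.1 hP.ae_mem_Δtri))
    rintro x ⟨-, y, hy, hyx⟩ hx
    exact hji (eq_of_Smap_eq hx (hAΔ hy) hyx.symm)
  · simp

lemma Sw_cons (i : Fin 3) (ω : List (Fin 3)) : Sw (i :: ω) = Smap i ∘ Sw ω := rfl

lemma continuous_Sw (ω : List (Fin 3)) : Continuous (Sw ω) := by
  induction ω with
  | nil => exact continuous_id
  | cons i ω ih => exact (continuous_Smap i).comp ih

lemma mapsTo_Sw (ω : List (Fin 3)) : MapsTo (Sw ω) Δtri Δtri := by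
  induction ω with
  | nil => exact mapsTo_id _
  | cons i ω ih => exact (mapsTo_Smap i).comp ih

lemma pw_nonneg (ω : List (Fin 3)) : 0 ≤ pw ω :=
  List.prod_nonneg (by simpa using fun i _ => pr_nonneg i)

lemma exists_Smap_eq (i : Fin 3) :
    ∃ u : ℝ × ℝ, ∀ x, Smap i x = (sr i * x.1 + u.1, sr i * x.2 + u.2) := by
  refine ⟨Smap i 0, fun x => ?_⟩
  fin_cases i <;> simp [Smap, sr] <;> constructor <;> ring

lemma exists_Sw_eq (ω : List (Fin 3)) :
    ∃ u : ℝ × ℝ, ∀ x, Sw ω x = (sw ω * x.1 + u.1, sw ω * x.2 + u.2) := by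
  induction ω with
  | nil => exact ⟨0, fun x => by simp [Sw, sw]⟩
  | cons i ω ih =>
    obtain ⟨u, hu⟩ := ih
    obtain ⟨v, hv⟩ := exists_Smap_eq i
    refine ⟨(sr i * u.1 + v.1, sr i * u.2 + v.2), fun x => ?_⟩
    have hsw : sw (i :: ω) = sr i * sw ω := by simp [sw]
    rw [Sw_cons, Function.comp_apply, hu, hv, hsw]
    ext <;> dsimp only <;> ring

lemma IsRMeasure.restrict_image_Sw {P : Measure (ℝ × ℝ)} [IsFiniteMeasure P]
    (hP : IsRMeasure P) (ω : List (Fin 3)) :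
    P.restrict (Sw ω '' Δtri) = ENNReal.ofReal (pw ω) • P.map (Sw ω) := by
  induction ω with
  | nil => simp [Sw, pw, Measure.restrict_eq_self_of_ae_mem hP.ae_mem_Δtri]
  | cons i ω ih =>
    have hpw : pw (i :: ω) = pr i * pw ω := by simp [pw]
    rw [Sw_cons, image_comp, hP.restrict_image_Smap i (isCompact_Δtri.image (continuous_Sw ω))
      (mapsTo_Sw ω).image_subset, ih, Measure.map_smul, smul_smul, hpw,
      ENNReal.ofReal_mul (pr_nonneg i),
      Measure.map_map (continuous_Smap i).measurable (continuous_Sw ω).measurable]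

lemma IsRMeasure.integrable {P : Measure (ℝ × ℝ)} [IsFiniteMeasure P] (hP : IsRMeasure P)
    {f : ℝ × ℝ → ℝ} (hf : Continuous f) : Integrable f P := by
  rw [← Measure.restrict_eq_self_of_ae_mem hP.ae_mem_Δtri]
  exact hf.continuousOn.integrableOn_compact isCompact_Δtri

lemma IsRMeasure.integral_eq {P : Measure (ℝ × ℝ)} [IsFiniteMeasure P] (hP : IsRMeasure P)
    {f : ℝ × ℝ → ℝ} (hf : Continuous f) :
    ∫ x, f x ∂P = ∑ i, pr i * ∫ x, f (Smap i x) ∂P := by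
  conv_lhs => rw [hP.eq_sum]
  rw [integral_finsetSum_measure]
  · refine Finset.sum_congr rfl fun i _ => ?_
    rw [integral_smul_measure, integral_map (continuous_Smap i).aemeasurable
      hf.aestronglyMeasurable, ENNReal.toReal_ofReal (pr_nonneg i), smul_eq_mul]
  · intro i _
    refine Integrable.smul_measure ?_ ENNReal.ofReal_ne_top
    rw [integrable_map_measure hf.aestronglyMeasurable (continuous_Smap i).aemeasurable]
    exact hP.integrable (hf.comp (continuous_Smap i))

lemma IsRMeasure.integral_fst {P : Measure (ℝ × ℝ)} [IsProbabilityMeasure P]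
    (hP : IsRMeasure P) : ∫ x, x.1 ∂P = 1 / 2 := by
  have h := hP.integral_eq continuous_fst
  have hint : Integrable (fun x : ℝ × ℝ => x.1) P := hP.integrable continuous_fst
  simp only [Fin.sum_univ_three, pr, Smap, Matrix.cons_val_zero, Matrix.cons_val_one,
    Matrix.cons_val] at h
  rw [integral_add (hint.div_const _) (integrable_const _),
    integral_add (hint.div_const _) (integrable_const _)] at h
  simp only [integral_div, integral_const, probReal_univ, smul_eq_mul] at h
  linarith

lemma IsRMeasure.integral_snd {P : Measure (ℝ × ℝ)} [IsProbabilityMeasure P]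
    (hP : IsRMeasure P) : ∫ x, x.2 ∂P = √3 / 4 := by
  have h := hP.integral_eq continuous_snd
  have hint : Integrable (fun x : ℝ × ℝ => x.2) P := hP.integrable continuous_snd
  simp only [Fin.sum_univ_three, pr, Smap, Matrix.cons_val_zero, Matrix.cons_val_one,
    Matrix.cons_val] at h
  rw [integral_add (hint.div_const _) (integrable_const _)] at h
  simp only [integral_div, integral_const, probReal_univ, smul_eq_mul] at h
  linarith

lemma continuous_sqDist (a : ℝ × ℝ) : Continuous fun x => sqDist x a := by
  unfold sqDist; fun_prop

/-- The parallel-axis formula for a similar copy of an R-measure. -/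
lemma IsRMeasure.integral_sqDist_similar {P : Measure (ℝ × ℝ)} [IsProbabilityMeasure P]
    (hP : IsRMeasure P) (s : ℝ) (u a : ℝ × ℝ) :
    ∫ x, sqDist (s * x.1 + u.1, s * x.2 + u.2) a ∂P =
      s ^ 2 * ∫ x, sqDist x (1 / 2, √3 / 4) ∂P +
        sqDist (s * (1 / 2) + u.1, s * (√3 / 4) + u.2) a := by
  set c : ℝ := s * (1 / 2) + u.1 - a.1
  set d : ℝ := s * (√3 / 4) + u.2 - a.2
  have hexp (x : ℝ × ℝ) : sqDist (s * x.1 + u.1, s * x.2 + u.2) a =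
      s ^ 2 * sqDist x (1 / 2, √3 / 4) + (2 * s * c * x.1 + (2 * s * d * x.2 +
        (c ^ 2 + d ^ 2 - s * c - 2 * s * d * (√3 / 4)))) := by
    simp only [sqDist, c, d]; ring
  have h1 : Integrable (fun x => s ^ 2 * sqDist x (1 / 2, √3 / 4)) P :=
    (hP.integrable (continuous_sqDist _)).const_mul _
  have h2 : Integrable (fun x : ℝ × ℝ => 2 * s * c * x.1) P :=
    (hP.integrable continuous_fst).const_mul _
  have h3 : Integrable (fun x : ℝ × ℝ => 2 * s * d * x.2) P :=
    (hP.integrable continuous_snd).const_mul _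
  have h34 : Integrable (fun x : ℝ × ℝ => 2 * s * d * x.2 +
      (c ^ 2 + d ^ 2 - s * c - 2 * s * d * (√3 / 4))) P := h3.add (integrable_const _)
  have h234 : Integrable (fun x : ℝ × ℝ => 2 * s * c * x.1 + (2 * s * d * x.2 +
      (c ^ 2 + d ^ 2 - s * c - 2 * s * d * (√3 / 4)))) P := h2.add h34
  simp only [hexp]
  rw [integral_add h1 h234, integral_add h2 h34, integral_add h3 (integrable_const _)]
  simp only [integral_const_mul, integral_const, probReal_univ, smul_eq_mul, hP.integral_fst,
    hP.integral_snd, sqDist, c, d]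
  ring

lemma IsRMeasure.variance_eq {P : Measure (ℝ × ℝ)} [IsProbabilityMeasure P]
    (hP : IsRMeasure P) : ∫ x, sqDist x (1 / 2, √3 / 4) ∂P = 27 / 176 := by
  have h := hP.integral_eq (continuous_sqDist (1 / 2, √3 / 4))
  have hS (i : Fin 3) : ∫ x, sqDist (Smap i x) (1 / 2, √3 / 4) ∂P =
      sr i ^ 2 * ∫ x, sqDist x (1 / 2, √3 / 4) ∂P +
        sqDist (Smap i (1 / 2, √3 / 4)) (1 / 2, √3 / 4) := by
    obtain ⟨u, hu⟩ := exists_Smap_eq i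
    simp only [hu]
    exact hP.integral_sqDist_similar (sr i) u _
  have h3 : √3 ^ 2 = 3 := Real.sq_sqrt (by norm_num)
  simp only [hS, Fin.sum_univ_three, pr, sr, Matrix.cons_val_zero, Matrix.cons_val_one,
    Matrix.cons_val] at h
  generalize ∫ x, sqDist x (1 / 2, √3 / 4) ∂P = V at h ⊢
  simp only [Smap, sqDist, Matrix.cons_val_zero, Matrix.cons_val_one, Matrix.cons_val] at h
  ring_nf at h
  rw [h3] at h
  linarith

/-- For a word ω of length k ≥ 1 and (a,b) ∈ ℝ²,
`∫_{Δ_ω} ‖x − (a,b)‖² dP = p_ω (s_ω² · 27/176 + ‖S_ω(1/2,√3/4) − (a,b)‖²)`. -/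
theorem stmt_8 (P : Measure (ℝ × ℝ)) [IsProbabilityMeasure P] (hP : IsRMeasure P)
    (ω : List (Fin 3)) (hω : 1 ≤ ω.length) (a b : ℝ) :
    (∫ x in Sw ω '' Δtri, sqDist x (a, b) ∂P) =
      pw ω * (sw ω ^ 2 * (27/176) + sqDist (Sw ω (1/2, Real.sqrt 3 / 4)) (a, b)) := by
  rw [hP.restrict_image_Sw ω, integral_smul_measure,
    integral_map (continuous_Sw ω).aemeasurable (continuous_sqDist _).aestronglyMeasurable,
    ENNReal.toReal_ofReal (pw_nonneg ω), smul_eq_mul]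
  obtain ⟨u, hu⟩ := exists_Sw_eq ω
  simp only [hu]
  rw [hP.integral_sqDist_similar, hP.variance_eq]
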